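/- Suppose the weight vector w is random: w_1, …, w_n are independent ℕ-valued random variables, each taking values in {0, 1, …, 2^n − 1}, and each attaining any single value with probability at most p. Fix a threshold t ∈ ℕ and a number of revealed bits b ∈ ℕ with b ≤ n, and let ⌊a⌋_b = 2^{n−b}·⌊a / 2^{n−b}⌋ denote the rounding of a ∈ ℕ to its b most significant (out of n) bits, applied coordinatewise to w. Then the probability that there exists a solution x ∈ S satisfying ⌊w⌋_bᵀ x ≤ t and either x ≻ x*(t) or no winner x*(t) exists, is at most 2^{n−b} · p · n². -/

import Mathlib

open scoped ENNReal

/-- `wdot w x = wᵀx` for a weight vector `w ∈ ℕⁿ` and a 0/1 solution vector `x`. -/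
def wdot {n : ℕ} (w : Fin n → ℕ) (x : Fin n → Bool) : ℕ :=
  ∑ i, w i * (x i).toNat

/-- A ranking is monotone if `x ≻ y` implies `xᵢ = 1` and `yᵢ = 0` for some `i`. -/
def MonotoneRanking {n : ℕ} (succ : (Fin n → Bool) → (Fin n → Bool) → Prop) : Prop :=
  ∀ x y, succ x y → ∃ i, x i = true ∧ y i = false

/-- The winner `x*(t)`: the `≻`-largest solution in `S` with `wᵀx ≤ t`. -/
def IsWinner {n : ℕ} (S : Set (Fin n → Bool))
    (succ : (Fin n → Bool) → (Fin n → Bool) → Prop)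
    (w : Fin n → ℕ) (t : ℕ) (xs : Fin n → Bool) : Prop :=
  xs ∈ S ∧ wdot w xs ≤ t ∧
    ∀ y ∈ S, wdot w y ≤ t → y ≠ xs → succ xs y

/-- `⌊a⌋_b = 2^{n−b}·⌊a / 2^{n−b}⌋`: rounding an `n`-bit number `a` to its `b` most
significant bits. -/
def roundTop (n b a : ℕ) : ℕ := 2 ^ (n - b) * (a / 2 ^ (n - b))

theorem wdot_add_of_agree {n : ℕ} {w w' : Fin n → ℕ} {i : Fin n}
    (h : ∀ j, j ≠ i → w j = w' j) (x : Fin n → Bool) :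
    wdot w x + w' i * (x i).toNat = wdot w' x + w i * (x i).toNat := by
  unfold wdot
  rw [← Finset.add_sum_erase _ _ (Finset.mem_univ i),
    ← Finset.add_sum_erase _ (fun j => w' j * (x j).toNat) (Finset.mem_univ i),
    Finset.sum_congr rfl fun j hj => by rw [h j (Finset.ne_of_mem_erase hj)]]
  ring

theorem wdot_le_wdot_roundTop_add {n : ℕ} (b : ℕ) (w : Fin n → ℕ) (x : Fin n → Bool) :
    wdot w x ≤ wdot (fun i => roundTop n b (w i)) x + n * 2 ^ (n - b) := by
  have hconst : n * 2 ^ (n - b) = ∑ _i : Fin n, 2 ^ (n - b) := by simp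
  rw [hconst, wdot, wdot, ← Finset.sum_add_distrib]
  refine Finset.sum_le_sum fun i _ => ?_
  have h1 := Nat.div_add_mod (w i) (2 ^ (n - b))
  have h2 := Nat.mod_lt (w i) (Nat.two_pow_pos (n - b))
  cases x i <;> simp only [roundTop, Bool.toNat_true, Bool.toNat_false] <;> omega

section Winner

variable {n : ℕ} {S : Set (Fin n → Bool)} {succ : (Fin n → Bool) → (Fin n → Bool) → Prop}

theorem exists_isWinner [IsStrictTotalOrder (Fin n → Bool) succ] {w : Fin n → ℕ} {t : ℕ}
    {x : Fin n → Bool} (hx : x ∈ S) (hxt : wdot w x ≤ t) : ∃ xs, IsWinner S succ w t xs := by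
  have hwf : WellFounded succ := Finite.wellFounded_of_trans_of_irrefl succ
  obtain ⟨m, ⟨hmS, hmt⟩, hmin⟩ := hwf.has_min {y | y ∈ S ∧ wdot w y ≤ t} ⟨x, hx, hxt⟩
  refine ⟨m, hmS, hmt, fun y hy hyt hne => ?_⟩
  rcases trichotomous_of succ y m with h | h | h
  · exact absurd h (hmin y ⟨hy, hyt⟩)
  · exact absurd h hne
  · exact h

theorem IsWinner.unique [IsStrictTotalOrder (Fin n → Bool) succ] {w : Fin n → ℕ} {t : ℕ}
    {x y : Fin n → Bool} (hx : IsWinner S succ w t x) (hy : IsWinner S succ w t y) : x = y := by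
  by_contra hne
  exact asymm_of succ (hx.2.2 y hy.1 hy.2.1 (Ne.symm hne)) (hy.2.2 x hx.1 hx.2.1 hne)

variable (S succ) in
/-- The losers: solutions ranked above the winner, or all solutions if there is no winner. -/
def losers (w : Fin n → ℕ) (t : ℕ) : Set (Fin n → Bool) :=
  {x | x ∈ S ∧ ∀ xs, IsWinner S succ w t xs → succ x xs}

theorem lt_wdot_of_mem_losers [IsStrictTotalOrder (Fin n → Bool) succ] {w : Fin n → ℕ} {t : ℕ}
    {x : Fin n → Bool} (hx : x ∈ losers S succ w t) : t < wdot w x := by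
  by_contra! hle
  obtain ⟨xs, hxs⟩ := exists_isWinner (succ := succ) hx.1 hle
  have h := hx.2 xs hxs
  have hne : x ≠ xs := by
    rintro rfl
    exact irrefl_of succ x h
  exact asymm_of succ h (hxs.2.2 x hx.1 hle hne)

variable (S succ) in
/-- The solutions containing item `i` that are ranked above the winner among the solutions
avoiding `i` (all solutions containing `i` if the latter does not exist). -/
def losersAt (i : Fin n) (w : Fin n → ℕ) (t : ℕ) : Set (Fin n → Bool) :=
  {x | x ∈ S ∧ x i = true ∧ ∀ xs, IsWinner {y ∈ S | y i = false} succ w t xs → succ x xs}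

variable (S succ) in
/-- The weight vectors for which the lightest element of `losersAt` exceeds the threshold by
at least `1` and at most `g`. -/
def smallGapAt (t g : ℕ) (i : Fin n) : Set (Fin n → ℕ) :=
  {w | ∃ x ∈ losersAt S succ i w t, t < wdot w x ∧ wdot w x ≤ t + g ∧
    ∀ y ∈ losersAt S succ i w t, wdot w x ≤ wdot w y}

theorem IsWinner.of_agree {w w' : Fin n → ℕ} {i : Fin n} (h : ∀ j, j ≠ i → w j = w' j) {t : ℕ}
    {xs : Fin n → Bool} (hxs : IsWinner {y ∈ S | y i = false} succ w t xs) :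
    IsWinner {y ∈ S | y i = false} succ w' t xs := by
  have heq : ∀ y : Fin n → Bool, y i = false → wdot w y = wdot w' y := fun y hy => by
    simpa [hy] using wdot_add_of_agree h y
  exact ⟨hxs.1, heq xs hxs.1.2 ▸ hxs.2.1,
    fun y hy hyt => hxs.2.2 y hy ((heq y hy.2).symm ▸ hyt)⟩

theorem losersAt_subset_of_agree {w w' : Fin n → ℕ} {i : Fin n}
    (h : ∀ j, j ≠ i → w j = w' j) (t : ℕ) : losersAt S succ i w t ⊆ losersAt S succ i w' t :=
  fun _ hx => ⟨hx.1, hx.2.1, fun xs hxs =>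
    hx.2.2 xs (hxs.of_agree fun j hj => (h j hj).symm)⟩

theorem lt_add_of_mem_smallGapAt {w w' : Fin n → ℕ} {i : Fin n} (h : ∀ j, j ≠ i → w j = w' j)
    {t g : ℕ} (hw : w ∈ smallGapAt S succ t g i) (hw' : w' ∈ smallGapAt S succ t g i) :
    w i < w' i + g := by
  obtain ⟨x, hx, -, hxg, -⟩ := hw
  obtain ⟨x', hx', hxt', -, hmin'⟩ := hw'
  have h1 := hmin' x (losersAt_subset_of_agree h t hx)
  have h2 := wdot_add_of_agree h x
  simp only [hx.2.1, Bool.toNat_true, mul_one] at h2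
  omega

theorem exists_mem_smallGapAt [IsStrictTotalOrder (Fin n → Bool) succ]
    (hmono : MonotoneRanking succ) (h0 : (fun _ => false) ∉ S) {w : Fin n → ℕ} {t g : ℕ}
    {x : Fin n → Bool} (hx : x ∈ losers S succ w t) (hxg : wdot w x ≤ t + g) :
    ∃ i, w ∈ smallGapAt S succ t g i := by
  obtain ⟨z, hz, hmin⟩ := Set.exists_min_image _ (wdot w) (Set.toFinite (losers S succ w t)) ⟨x, hx⟩
  have hzt := lt_wdot_of_mem_losers hz
  have hzg := (hmin x hx).trans hxg
  by_cases hex : ∃ xs, IsWinner S succ w t xs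
  · obtain ⟨xs, hxs⟩ := hex
    obtain ⟨i, hzi, hxi⟩ := hmono z xs (hz.2 xs hxs)
    have hxs' : IsWinner {y ∈ S | y i = false} succ w t xs :=
      ⟨⟨hxs.1, hxi⟩, hxs.2.1, fun y hy => hxs.2.2 y hy.1⟩
    refine ⟨i, z, ⟨hz.1, hzi, fun ys hys => hys.unique hxs' ▸ hz.2 xs hxs⟩, hzt, hzg,
      fun y hy => hmin y ⟨hy.1, fun ys hys => hys.unique hxs ▸ hy.2.2 xs hxs'⟩⟩
  · obtain ⟨i, hzi⟩ : ∃ i, z i = true := by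
      by_contra! hall
      have hz0 : z = fun _ => false := funext fun i => by simpa using hall i
      exact h0 (hz0 ▸ hz.1)
    exact ⟨i, z, ⟨hz.1, hzi, fun ys hys => absurd (exists_isWinner hys.1.1 hys.2.1) hex⟩,
      hzt, hzg, fun y hy => hmin y ⟨hy.1, fun ys hys => absurd ⟨ys, hys⟩ hex⟩⟩

end Winner

theorem PMF.tsum_pi_prod {ι : Type*} [Fintype ι] (D : ι → PMF ℕ) :
    ∑' f : ι → ℕ, ∏ i, D i (f i) = 1 := by
  have hpi : ∀ f : ι → ℕ,
      ∏ i, D i (f i) = MeasureTheory.Measure.pi (fun i => (D i).toMeasure) {f} := fun f => by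
    rw [MeasureTheory.Measure.pi_singleton]
    exact Finset.prod_congr rfl fun i _ =>
      ((D i).toMeasure_apply_singleton _ (measurableSet_singleton _)).symm
  simp_rw [hpi]
  simpa using MeasureTheory.Measure.tsum_indicator_apply_singleton
    (MeasureTheory.Measure.pi fun i => (D i).toMeasure) Set.univ MeasurableSet.univ

theorem tsum_indicator_le_of_lt_add {T : Set ℕ} {g : ℕ} (hT : ∀ k ∈ T, ∀ l ∈ T, k < l + g)
    {f : ℕ → ℝ≥0∞} {q : ℝ≥0∞} (hf : ∀ k, f k ≤ q) : ∑' k, T.indicator f k ≤ g * q := by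
  rcases T.eq_empty_or_nonempty with rfl | hne
  · simp
  have hsub : T ⊆ Finset.Ico (sInf T) (sInf T + g) := fun k hk =>
    Finset.mem_coe.2 (Finset.mem_Ico.2 ⟨Nat.sInf_le hk, hT k hk _ (Nat.sInf_mem hne)⟩)
  rw [tsum_eq_sum fun k hk => Set.indicator_of_notMem (fun h => hk (hsub h)) f]
  refine (Finset.sum_le_card_nsmul _ _ q fun k _ => ?_).trans (by simp)
  exact (Set.indicator_le_self' (fun _ _ => zero_le) k).trans (hf k)

/-- If all values of `w i` compatible with `A` and a given choice of the other coordinates lie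
in a window of length `g`, then `A` has probability at most `g * q`. -/
theorem tsum_indicator_prod_le {ι : Type*} [Fintype ι] [DecidableEq ι] (D : ι → PMF ℕ)
    {q : ℝ≥0∞} {i : ι} (hD : ∀ k, D i k ≤ q) {A : Set (ι → ℕ)} {g : ℕ}
    (hA : ∀ w ∈ A, ∀ w' ∈ A, (∀ j, j ≠ i → w j = w' j) → w i < w' i + g) :
    ∑' w, A.indicator (fun w => ∏ j, D j (w j)) w ≤ g * q := by
  set e := (Equiv.funSplitAt i ℕ).symm with he
  have hi : ∀ k f, e (k, f) i = k := fun k f => by simp [he]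
  have hj : ∀ k f (j : {j // j ≠ i}), e (k, f) j = f j := fun k f j => by simp [he, j.2]
  have hprod : ∀ k f, ∏ j, D j (e (k, f) j) = D i k * ∏ j : {j // j ≠ i}, D j (f j) := by
    intro k f
    rw [Fintype.prod_eq_mul_prod_subtype_ne _ i, hi]
    simp_rw [hj]
  have hind : ∀ k f, A.indicator (fun w => ∏ j, D j (w j)) (e (k, f)) =
      {k | e (k, f) ∈ A}.indicator (D i) k * ∏ j : {j // j ≠ i}, D j (f j) := by
    intro k f
    by_cases h : e (k, f) ∈ A <;> simp [Set.indicator, h, hprod]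
  rw [← e.tsum_eq, ENNReal.tsum_prod', ENNReal.tsum_comm]
  simp_rw [hind, ENNReal.tsum_mul_right]
  calc _ ≤ ∑' f : {j // j ≠ i} → ℕ, g * q * ∏ j : {j // j ≠ i}, D j (f j) := by
        refine ENNReal.tsum_le_tsum fun f => mul_le_mul_left ?_ _
        refine tsum_indicator_le_of_lt_add (fun k hk l hl => ?_) hD
        have := hA _ hk _ hl fun j hji => by rw [hj k f ⟨j, hji⟩, hj l f ⟨j, hji⟩]
        rwa [hi, hi] at this
    _ = g * q := by rw [ENNReal.tsum_mul_left, PMF.tsum_pi_prod fun j : {j // j ≠ i} => D j, mul_one]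

/-- The paper's Lemma 5: if the coordinates of `w` are independent, take values in
`{0, …, 2ⁿ − 1}`, and have point masses at most `p`, then the probability that some
solution `x ∈ S` is feasible with respect to the weights rounded to their `b` most
significant bits while being ranked above the winner `x*(t)` (or while no winner
exists) is at most `2^{n−b}·p·n²`. -/
theorem rounding_lemma {n : ℕ} (S : Set (Fin n → Bool))
    (succ : (Fin n → Bool) → (Fin n → Bool) → Prop)
    (hsto : IsStrictTotalOrder (Fin n → Bool) succ)
    (hmono : MonotoneRanking succ)
    (h0 : (fun _ => false) ∉ S)
    (D : Fin n → PMF ℕ) (p : ℝ) (hp : 0 ≤ p)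
    (hbound : ∀ i k, D i k ≤ ENNReal.ofReal p)
    (hrange : ∀ i k, 0 < D i k → k < 2 ^ n)
    (t b : ℕ) (hb : b ≤ n) :
    (∑' w : {w : Fin n → ℕ | ∃ x ∈ S,
        wdot (fun i => roundTop n b (w i)) x ≤ t ∧
        ∀ xs, IsWinner S succ w t xs → succ x xs},
      ∏ i, D i (w.1 i)) ≤ ENNReal.ofReal (2 ^ (n - b) * p * n ^ 2) := by
  have hsub : {w : Fin n → ℕ | ∃ x ∈ S,
      wdot (fun i => roundTop n b (w i)) x ≤ t ∧
      ∀ xs, IsWinner S succ w t xs → succ x xs} ⊆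
        ⋃ i, smallGapAt S succ t (n * 2 ^ (n - b)) i := by
    rintro w ⟨x, hxS, hxt, hx⟩
    exact Set.mem_iUnion.2 (exists_mem_smallGapAt hmono h0 ⟨hxS, hx⟩
      ((wdot_le_wdot_roundTop_add b w x).trans (by gcongr)))
  calc _ ≤ ∑' w : ⋃ i, smallGapAt S succ t (n * 2 ^ (n - b)) i, ∏ i, D i (w.1 i) :=
        ENNReal.tsum_mono_subtype (fun w : Fin n → ℕ => ∏ i, D i (w i)) hsub
    _ ≤ ∑ i, ∑' w : smallGapAt S succ t (n * 2 ^ (n - b)) i, ∏ j, D j (w.1 j) :=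
        ENNReal.tsum_iUnion_le (fun w : Fin n → ℕ => ∏ i, D i (w i)) _
    _ ≤ ∑ _i : Fin n, ((n * 2 ^ (n - b) : ℕ) : ℝ≥0∞) * ENNReal.ofReal p := by
        refine Finset.sum_le_sum fun i _ => ?_
        rw [tsum_subtype _ fun w : Fin n → ℕ => ∏ j, D j (w j)]
        exact tsum_indicator_prod_le D (hbound i) fun w hw w' hw' h =>
          lt_add_of_mem_smallGapAt h hw hw'
    _ = ENNReal.ofReal (2 ^ (n - b) * p * n ^ 2) := by
        rw [Finset.sum_const, Finset.card_univ, Fintype.card_fin, nsmul_eq_mul,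
          ← ENNReal.ofReal_natCast, ← ENNReal.ofReal_natCast,
          ← ENNReal.ofReal_mul (by positivity), ← ENNReal.ofReal_mul (by positivity)]
        congr 1
        push_cast
        ring
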